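/- arXiv:2207.08446 — 2 statements merged into one kernel-verified Lean document; each statement's English description precedes it below -/
import Mathlib

section
/- The group homomorphism Γ : J_{sp(2n)} → J_{2n} determined by s_{[p,q]} ↦ s_{[p,q]} s_{[2n−q,2n−p]} for 1 ≤ p ≤ q ≤ n−1 and s_{[p,n]} ↦ s_{[p,2n−p]} for 1 ≤ p ≤ n is injective; hence the symplectic cactus group J_{sp(2n)} embeds as a subgroup of the cactus group J_{2n}. -/
/-- Index type for generators of a cactus group on a path with `N` nodes:
intervals `[p,q]` with `1 ≤ p ≤ q ≤ N`. -/
abbrev CactusIdx (N : ℕ) : Type := {pq : ℕ × ℕ // 1 ≤ pq.1 ∧ pq.1 ≤ pq.2 ∧ pq.2 ≤ N}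

/-- Defining relations of the (type A) cactus group with `N` nodes:
(1A) `s_{[p,q]}² = 1`; (2A) commutation for disjoint non-adjacent intervals;
(3A) `s_{[p,q]} s_{[k,l]} = s_{[p+q-l,p+q-k]} s_{[p,q]}` for `[k,l] ⊆ [p,q]`. -/
inductive CactusRel (N : ℕ) : FreeGroup (CactusIdx N) → Prop
  | sq (i : CactusIdx N) :
      CactusRel N (FreeGroup.of i * FreeGroup.of i)
  | comm (i j : CactusIdx N) (h : i.1.2 + 1 < j.1.1 ∨ j.1.2 + 1 < i.1.1) :
      CactusRel N (FreeGroup.of i * FreeGroup.of j * (FreeGroup.of i)⁻¹ * (FreeGroup.of j)⁻¹)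
  | nest (i j k : CactusIdx N) (h1 : i.1.1 ≤ j.1.1) (h2 : j.1.2 ≤ i.1.2)
      (h3 : k.1.1 = i.1.1 + i.1.2 - j.1.2) (h4 : k.1.2 = i.1.1 + i.1.2 - j.1.1) :
      CactusRel N (FreeGroup.of i * FreeGroup.of j * (FreeGroup.of i)⁻¹ * (FreeGroup.of k)⁻¹)

/-- The (type A) cactus group with `N` nodes (so `CactusGroup (2*n-1)` is `J_{2n}`
and `CactusGroup (n-1)` is `J_n`). -/
abbrev CactusGroup (N : ℕ) := PresentedGroup {x | CactusRel N x}

/-- The generator `s_{[p,q]}` of the cactus group (equal to `1` for invalid indices). -/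
def cactusGen (N p q : ℕ) : CactusGroup N :=
  if h : 1 ≤ p ∧ p ≤ q ∧ q ≤ N then PresentedGroup.of ⟨(p, q), h⟩ else 1

/-- `s'_{[p,q]} := s_{[p,q]} s_{[2n-q,2n-p]}` in the cactus group `J_{2n}`. -/
def sPrime (n p q : ℕ) : CactusGroup (2 * n - 1) :=
  cactusGen (2 * n - 1) p q * cactusGen (2 * n - 1) (2 * n - q) (2 * n - p)

/-- Defining relations of the symplectic cactus group `J_{sp(2n)}`, with generators
`s_{[p,q]}`, `1 ≤ p ≤ q ≤ n`: (1C) squares; (2C) commutation for disjoint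
non-adjacent intervals; (3C-i) `s_{[p,n]}` commutes with `s_{[k,l]}` for `[k,l] ⊆ [p,n]`;
(3C-ii) `s_{[p,q]} s_{[k,l]} = s_{[p+q-l,p+q-k]} s_{[p,q]}` for `[k,l] ⊆ [p,q] ⊆ [1,n-1]`. -/
inductive SpCactusRel (n : ℕ) : FreeGroup (CactusIdx n) → Prop
  | sq (i : CactusIdx n) :
      SpCactusRel n (FreeGroup.of i * FreeGroup.of i)
  | comm (i j : CactusIdx n) (h : i.1.2 + 1 < j.1.1 ∨ j.1.2 + 1 < i.1.1) :
      SpCactusRel n (FreeGroup.of i * FreeGroup.of j * (FreeGroup.of i)⁻¹ * (FreeGroup.of j)⁻¹)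
  | nestC (i j : CactusIdx n) (hq : i.1.2 = n) (h1 : i.1.1 ≤ j.1.1) :
      SpCactusRel n (FreeGroup.of i * FreeGroup.of j * (FreeGroup.of i)⁻¹ * (FreeGroup.of j)⁻¹)
  | nestA (i j k : CactusIdx n) (hq : i.1.2 ≤ n - 1) (h1 : i.1.1 ≤ j.1.1) (h2 : j.1.2 ≤ i.1.2)
      (h3 : k.1.1 = i.1.1 + i.1.2 - j.1.2) (h4 : k.1.2 = i.1.1 + i.1.2 - j.1.1) :
      SpCactusRel n (FreeGroup.of i * FreeGroup.of j * (FreeGroup.of i)⁻¹ * (FreeGroup.of k)⁻¹)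

/-- The symplectic cactus group `J_{sp(2n)}`. -/
abbrev SpCactusGroup (n : ℕ) := PresentedGroup {x | SpCactusRel n x}

/-- The generator `s_{[p,q]}` of `J_{sp(2n)}` (equal to `1` for invalid indices). -/
def spGen (n p q : ℕ) : SpCactusGroup n :=
  if h : 1 ≤ p ∧ p ≤ q ∧ q ≤ n then PresentedGroup.of ⟨(p, q), h⟩ else 1

/-! ### Relations between generators -/

lemma cactusGen_mul_self (N p q : ℕ) : cactusGen N p q * cactusGen N p q = 1 := by
  unfold cactusGen
  split_ifs with h
  · exact PresentedGroup.one_of_mem (CactusRel.sq ⟨(p, q), h⟩)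
  · simp

lemma cactusGen_commute (N p q k l : ℕ) (h : q + 1 < k) :
    Commute (cactusGen N p q) (cactusGen N k l) := by
  unfold cactusGen
  split_ifs with h₁ h₂
  · have := PresentedGroup.one_of_mem (CactusRel.comm (N := N) ⟨(p, q), h₁⟩ ⟨(k, l), h₂⟩ (Or.inl h))
    simp only [map_mul] at this
    exact mul_inv_eq_iff_eq_mul.mp (mul_inv_eq_one.mp this)
  all_goals simp

lemma cactusGen_mul_of_nested (N p q k l : ℕ) (hp : 1 ≤ p) (hpk : p ≤ k) (hkl : k ≤ l)
    (hlq : l ≤ q) (hq : q ≤ N) :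
    cactusGen N p q * cactusGen N k l =
      cactusGen N (p + q - l) (p + q - k) * cactusGen N p q := by
  unfold cactusGen
  rw [dif_pos (by omega), dif_pos (by omega), dif_pos (by omega)]
  have := PresentedGroup.one_of_mem (CactusRel.nest (N := N) ⟨(p, q), by omega⟩ ⟨(k, l), by omega⟩
    ⟨(p + q - l, p + q - k), by dsimp only; omega⟩ hpk hlq rfl rfl)
  simp only [map_mul] at this
  exact mul_inv_eq_iff_eq_mul.mp (mul_inv_eq_one.mp this)

namespace SpCactusGroup

/-- The generator of the symplectic cactus group with a bundled index. -/
def gen {n : ℕ} (i : CactusIdx n) : SpCactusGroup n := PresentedGroup.of i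

lemma gen_mul_self {n : ℕ} (i : CactusIdx n) : gen i * gen i = 1 :=
  PresentedGroup.one_of_mem (SpCactusRel.sq i)

lemma gen_mul_cancel_left {n : ℕ} (i : CactusIdx n) (g : SpCactusGroup n) :
    gen i * (gen i * g) = g := by
  rw [← mul_assoc, gen_mul_self, one_mul]

lemma gen_comm {n : ℕ} (i j : CactusIdx n) (h : i.1.2 + 1 < j.1.1 ∨ j.1.2 + 1 < i.1.1) :
    gen i * gen j = gen j * gen i := by
  have := PresentedGroup.one_of_mem (SpCactusRel.comm i j h)
  simp only [map_mul] at this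
  exact mul_inv_eq_iff_eq_mul.mp (mul_inv_eq_one.mp this)

lemma gen_comm_of_eq {n : ℕ} (i j : CactusIdx n) (hq : i.1.2 = n) (h : i.1.1 ≤ j.1.1) :
    gen i * gen j = gen j * gen i := by
  have := PresentedGroup.one_of_mem (SpCactusRel.nestC i j hq h)
  simp only [map_mul] at this
  exact mul_inv_eq_iff_eq_mul.mp (mul_inv_eq_one.mp this)

lemma gen_mul_of_nested {n : ℕ} (i j k : CactusIdx n) (hq : i.1.2 ≤ n - 1) (h1 : i.1.1 ≤ j.1.1)
    (h2 : j.1.2 ≤ i.1.2) (h3 : k.1.1 = i.1.1 + i.1.2 - j.1.2)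
    (h4 : k.1.2 = i.1.1 + i.1.2 - j.1.1) :
    gen i * gen j = gen k * gen i := by
  have := PresentedGroup.one_of_mem (SpCactusRel.nestA i j k hq h1 h2 h3 h4)
  simp only [map_mul] at this
  exact mul_inv_eq_iff_eq_mul.mp (mul_inv_eq_one.mp this)

/-! ### Word length -/

lemma exists_word {n : ℕ} (g : SpCactusGroup n) :
    ∃ l : List (CactusIdx n), (l.map gen).prod = g := by
  have hg : g ∈ Subgroup.closure (Set.range (PresentedGroup.of (rels := {x | SpCactusRel n x}))) := by
    rw [PresentedGroup.closure_range_of]; trivial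
  induction hg using Subgroup.closure_induction with
  | mem x hx =>
    obtain ⟨i, rfl⟩ := hx
    exact ⟨[i], by simp [gen]⟩
  | one => exact ⟨[], rfl⟩
  | mul x y _ _ hx hy =>
    obtain ⟨l, rfl⟩ := hx
    obtain ⟨l', rfl⟩ := hy
    exact ⟨l ++ l', by simp⟩
  | inv x _ hx =>
    obtain ⟨l, rfl⟩ := hx
    refine ⟨l.reverse, ?_⟩
    rw [List.prod_inv_reverse, List.map_reverse, List.map_map]
    congr 2
    refine List.map_congr_left fun i _ => ?_
    exact eq_inv_of_mul_eq_one_left (gen_mul_self i)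

/-- Length of a shortest word representing `g`. -/
noncomputable def length {n : ℕ} (g : SpCactusGroup n) : ℕ :=
  sInf {k | ∃ l : List (CactusIdx n), l.length = k ∧ (l.map gen).prod = g}

lemma exists_word_length {n : ℕ} (g : SpCactusGroup n) :
    ∃ l : List (CactusIdx n), l.length = length g ∧ (l.map gen).prod = g := by
  obtain ⟨l, hl⟩ := exists_word g
  exact Nat.sInf_mem (s := {k | ∃ l : List (CactusIdx n), l.length = k ∧ (l.map gen).prod = g})
    ⟨l.length, l, rfl, hl⟩

lemma length_prod_le {n : ℕ} (l : List (CactusIdx n)) : length (l.map gen).prod ≤ l.length :=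
  Nat.sInf_le ⟨l, rfl, rfl⟩

lemma length_gen_mul_le {n : ℕ} (i : CactusIdx n) (g : SpCactusGroup n) :
    length (gen i * g) ≤ length g + 1 := by
  obtain ⟨l, hl, hg⟩ := exists_word_length g
  have := length_prod_le (i :: l)
  simpa [hg, hl] using this

lemma eq_one_or_exists_length_lt {n : ℕ} (g : SpCactusGroup n) :
    g = 1 ∨ ∃ (i : CactusIdx n) (h : SpCactusGroup n), g = gen i * h ∧ length h < length g := by
  obtain ⟨l, hl, hg⟩ := exists_word_length g
  cases l with
  | nil => left; simpa using hg.symm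
  | cons i l =>
    right
    refine ⟨i, (l.map gen).prod, by simpa using hg.symm, ?_⟩
    have := length_prod_le l
    simp only [List.length_cons] at hl
    omega

end SpCactusGroup

/-! ### Folding -/

/-- Image of a generator of the symplectic cactus group under the folding homomorphism. -/
def foldGen (n : ℕ) (i : CactusIdx n) : CactusGroup (2 * n - 1) :=
  if i.1.2 = n then cactusGen (2 * n - 1) i.1.1 (2 * n - i.1.1) else sPrime n i.1.1 i.1.2

lemma foldGen_mul_self (n : ℕ) (i : CactusIdx n) : foldGen n i * foldGen n i = 1 := by
  obtain ⟨⟨p, q⟩, hp, hpq, hq⟩ := i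
  dsimp only at hp hpq hq
  simp only [foldGen, sPrime]
  split_ifs with h
  · exact cactusGen_mul_self _ _ _
  · have hc := cactusGen_commute (2 * n - 1) p q (2 * n - q) (2 * n - p) (by omega)
    rw [hc.symm.mul_mul_mul_comm, cactusGen_mul_self, cactusGen_mul_self, one_mul]

lemma foldGen_commute (n : ℕ) (i j : CactusIdx n) (h : i.1.2 + 1 < j.1.1) :
    Commute (foldGen n i) (foldGen n j) := by
  obtain ⟨⟨p, q⟩, hp, hpq, hq⟩ := i
  obtain ⟨⟨k, l⟩, hk, hkl, hl⟩ := j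
  dsimp only at hp hpq hq hk hkl hl h
  simp only [foldGen, sPrime]
  rw [if_neg (by omega)]
  split_ifs with hn
  · exact (cactusGen_commute _ _ _ _ _ (by omega)).mul_left
      (cactusGen_commute _ _ _ _ _ (by omega)).symm
  · exact ((cactusGen_commute _ _ _ _ _ (by omega)).mul_right
      (cactusGen_commute _ _ _ _ _ (by omega))).mul_left
      ((cactusGen_commute _ _ _ _ _ (by omega)).symm.mul_right
      (cactusGen_commute _ _ _ _ _ (by omega)).symm)

lemma foldGen_commute_of_eq (n : ℕ) (i j : CactusIdx n) (hn : i.1.2 = n) (h : i.1.1 ≤ j.1.1) :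
    Commute (foldGen n i) (foldGen n j) := by
  obtain ⟨⟨p, q⟩, hp, hpq, hq⟩ := i
  obtain ⟨⟨k, l⟩, hk, hkl, hl⟩ := j
  dsimp only at hp hpq hq hk hkl hl h hn
  simp only [foldGen, sPrime]
  rw [if_pos hn]
  split_ifs with hln
  · have := cactusGen_mul_of_nested (2 * n - 1) p (2 * n - p) k (2 * n - k) hp h (by omega)
      (by omega) (by omega)
    rwa [show p + (2 * n - p) - (2 * n - k) = k by omega,
      show p + (2 * n - p) - k = 2 * n - k by omega] at this
  · have h₁ := cactusGen_mul_of_nested (2 * n - 1) p (2 * n - p) k l hp h (by omega)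
      (by omega) (by omega)
    have h₂ := cactusGen_mul_of_nested (2 * n - 1) p (2 * n - p) (2 * n - l) (2 * n - k) hp
      (by omega) (by omega) (by omega) (by omega)
    have hc := cactusGen_commute (2 * n - 1) k l (2 * n - l) (2 * n - k) (by omega)
    rw [show p + (2 * n - p) - l = 2 * n - l by omega,
      show p + (2 * n - p) - k = 2 * n - k by omega] at h₁
    rw [show p + (2 * n - p) - (2 * n - k) = k by omega,
      show p + (2 * n - p) - (2 * n - l) = l by omega] at h₂
    rw [Commute, SemiconjBy, ← mul_assoc, h₁, mul_assoc, h₂, ← mul_assoc, ← hc.eq]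

lemma foldGen_mul_of_nested (n : ℕ) (i j k : CactusIdx n) (hq : i.1.2 ≤ n - 1)
    (h1 : i.1.1 ≤ j.1.1) (h2 : j.1.2 ≤ i.1.2) (h3 : k.1.1 = i.1.1 + i.1.2 - j.1.2)
    (h4 : k.1.2 = i.1.1 + i.1.2 - j.1.1) :
    foldGen n i * foldGen n j = foldGen n k * foldGen n i := by
  obtain ⟨⟨p, q⟩, hi⟩ := i
  obtain ⟨⟨a, b⟩, hj⟩ := j
  obtain ⟨⟨c, d⟩, hk⟩ := k
  dsimp only at *
  simp only [foldGen, sPrime]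
  rw [if_neg (by omega), if_neg (by omega), if_neg (by omega)]
  have e₁ := cactusGen_mul_of_nested (2 * n - 1) p q a b (by omega) h1 (by omega) h2 (by omega)
  have e₂ := cactusGen_mul_of_nested (2 * n - 1) (2 * n - q) (2 * n - p) (2 * n - b) (2 * n - a)
    (by omega) (by omega) (by omega) (by omega) (by omega)
  rw [← h3, ← h4] at e₁
  rw [show 2 * n - q + (2 * n - p) - (2 * n - a) = 2 * n - d by omega,
    show 2 * n - q + (2 * n - p) - (2 * n - b) = 2 * n - c by omega] at e₂
  have c₁ := cactusGen_commute (2 * n - 1) a b (2 * n - q) (2 * n - p) (by omega)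
  have c₂ := cactusGen_commute (2 * n - 1) p q (2 * n - d) (2 * n - c) (by omega)
  rw [c₁.symm.mul_mul_mul_comm, e₁, e₂, c₂.mul_mul_mul_comm]

/-- The folding homomorphism from the symplectic cactus group to the cactus group. -/
def foldHom (n : ℕ) : SpCactusGroup n →* CactusGroup (2 * n - 1) :=
  PresentedGroup.toGroup (f := foldGen n) <| by
    rintro r (⟨i⟩ | ⟨i, j, h⟩ | ⟨i, j, hq, h⟩ | ⟨i, j, k, hq, h1, h2, h3, h4⟩)
    · simpa using foldGen_mul_self n i
    · have : Commute (foldGen n i) (foldGen n j) :=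
        h.elim (foldGen_commute n i j) fun h => (foldGen_commute n j i h).symm
      simp [this.eq]
    · simp [(foldGen_commute_of_eq n i j hq h).eq]
    · simp [foldGen_mul_of_nested n i j k hq h1 h2 h3 h4]

lemma foldHom_gen (n : ℕ) (i : CactusIdx n) : foldHom n (SpCactusGroup.gen i) = foldGen n i :=
  PresentedGroup.toGroup.of _

/-! ### Weights on sets of integers

The cactus group acts on functions `Set ℤ → ℤ`: a generator reverses an interval and then acts
by a reflection of a right-angled Coxeter group whose generators are the sets, two of them
commuting when they are disjoint or nested. -/

/-- Two sets are compatible if they are disjoint or nested. -/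
def SetCompat (A B : Set ℤ) : Prop := Disjoint A B ∨ A ⊆ B ∨ B ⊆ A

lemma SetCompat.symm {A B : Set ℤ} (h : SetCompat A B) : SetCompat B A := by
  rcases h with h | h | h
  exacts [Or.inl h.symm, Or.inr (Or.inr h), Or.inr (Or.inl h)]

lemma SetCompat.preimage {A B : Set ℤ} (h : SetCompat A B) (f : ℤ → ℤ) :
    SetCompat (f ⁻¹' A) (f ⁻¹' B) := by
  rcases h with h | h | h
  exacts [Or.inl (h.preimage f), Or.inr (Or.inl (Set.preimage_mono h)),
    Or.inr (Or.inr (Set.preimage_mono h))]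

lemma Function.Involutive.preimage_preimage {f : ℤ → ℤ} (hf : Function.Involutive f)
    (A : Set ℤ) : f ⁻¹' (f ⁻¹' A) = A := by
  rw [← Set.preimage_comp, hf.comp_self, Set.preimage_id]

lemma Function.Involutive.setCompat_preimage_iff {f : ℤ → ℤ} (hf : Function.Involutive f)
    {A B : Set ℤ} : SetCompat (f ⁻¹' A) B ↔ SetCompat A (f ⁻¹' B) := by
  constructor <;> intro h <;> simpa [hf.preimage_preimage] using h.preimage f

open Classical in
/-- The reflection attached to the set `A`. -/
noncomputable def reflectAt (A : Set ℤ) (w : Set ℤ → ℤ) : Set ℤ → ℤ := fun B =>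
  if B = A then -w A else if SetCompat A B then w B else w B + 2 * w A

/-- Precomposition with taking preimages under a map of the integers. -/
def permuteSets (f : ℤ → ℤ) (w : Set ℤ → ℤ) : Set ℤ → ℤ := fun B => w (f ⁻¹' B)

lemma reflectAt_self (A : Set ℤ) (w : Set ℤ → ℤ) : reflectAt A w A = -w A := by
  simp [reflectAt]

lemma reflectAt_of_compat {A B : Set ℤ} (w : Set ℤ → ℤ) (hne : B ≠ A) (h : SetCompat A B) :
    reflectAt A w B = w B := by
  simp [reflectAt, hne, h]

lemma reflectAt_of_not_compat {A B : Set ℤ} (w : Set ℤ → ℤ) (h : ¬SetCompat A B) :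
    reflectAt A w B = w B + 2 * w A := by
  have hne : B ≠ A := by
    rintro rfl
    exact h (Or.inr (Or.inl subset_rfl))
  simp [reflectAt, hne, h]

lemma reflectAt_reflectAt (A : Set ℤ) (w : Set ℤ → ℤ) : reflectAt A (reflectAt A w) = w := by
  funext B
  by_cases hB : B = A
  · subst hB; simp [reflectAt_self]
  by_cases hc : SetCompat A B
  · rw [reflectAt_of_compat _ hB hc, reflectAt_of_compat _ hB hc]
  · rw [reflectAt_of_not_compat _ hc, reflectAt_of_not_compat _ hc, reflectAt_self]; ring

lemma reflectAt_comm {A A' : Set ℤ} (h : SetCompat A A') (w : Set ℤ → ℤ) :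
    reflectAt A (reflectAt A' w) = reflectAt A' (reflectAt A w) := by
  by_cases hA : A = A'
  · rw [hA]
  funext B
  have h₁ := reflectAt_of_compat w hA h.symm
  have h₂ := reflectAt_of_compat w (Ne.symm hA) h
  by_cases hB : B = A
  · subst hB
    rw [reflectAt_self, reflectAt_of_compat _ hA h.symm, reflectAt_of_compat _ hA h.symm,
      reflectAt_self]
  by_cases hB' : B = A'
  · subst hB'
    rw [reflectAt_self, reflectAt_of_compat _ hB h, h₂, reflectAt_self]
  by_cases hc : SetCompat A B <;> by_cases hc' : SetCompat A' B
  · simp only [reflectAt_of_compat _ hB hc, reflectAt_of_compat _ hB' hc']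
  · simp only [reflectAt_of_compat _ hB hc, reflectAt_of_not_compat _ hc', h₂]
  · simp only [reflectAt_of_not_compat _ hc, reflectAt_of_compat _ hB' hc', h₁]
  · simp only [reflectAt_of_not_compat _ hc, reflectAt_of_not_compat _ hc', h₁, h₂]; ring

lemma permuteSets_reflectAt {f : ℤ → ℤ} (hf : Function.Involutive f) (A : Set ℤ) (w : Set ℤ → ℤ) :
    permuteSets f (reflectAt A w) = reflectAt (f ⁻¹' A) (permuteSets f w) := by
  funext B
  have hiff : f ⁻¹' B = A ↔ B = f ⁻¹' A := by
    constructor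
    · rintro rfl; rw [hf.preimage_preimage]
    · rintro rfl; rw [hf.preimage_preimage]
  have hcompat : SetCompat A (f ⁻¹' B) ↔ SetCompat (f ⁻¹' A) B := hf.setCompat_preimage_iff.symm
  simp only [permuteSets, reflectAt, hiff, hf.preimage_preimage]
  split_ifs <;> first | rfl | (exfalso; tauto)

lemma permuteSets_permuteSets_self {f : ℤ → ℤ} (hf : Function.Involutive f) (w : Set ℤ → ℤ) :
    permuteSets f (permuteSets f w) = w := by
  funext B
  simp [permuteSets, hf.preimage_preimage]

/-- Reversal of the interval `[a, b]`. -/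
def reverseIcc (a b x : ℤ) : ℤ := if a ≤ x ∧ x ≤ b then a + b - x else x

lemma reverseIcc_involutive (a b : ℤ) : Function.Involutive (reverseIcc a b) := by
  intro x
  unfold reverseIcc
  split_ifs <;> omega

lemma reverseIcc_preimage_of_subset {a b c d : ℤ} (h₁ : a ≤ c) (h₂ : d ≤ b) :
    reverseIcc a b ⁻¹' Set.Icc c d = Set.Icc (a + b - d) (a + b - c) := by
  ext x
  simp only [Set.mem_preimage, Set.mem_Icc, reverseIcc]
  split_ifs <;> omega

lemma reverseIcc_preimage_of_superset {a b c d : ℤ} (h₁ : c ≤ a) (h₂ : b ≤ d) :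
    reverseIcc a b ⁻¹' Set.Icc c d = Set.Icc c d := by
  ext x
  simp only [Set.mem_preimage, Set.mem_Icc, reverseIcc]
  split_ifs <;> omega

lemma reverseIcc_preimage_of_disjoint {a b c d : ℤ} (h : b < c ∨ d < a) :
    reverseIcc a b ⁻¹' Set.Icc c d = Set.Icc c d := by
  ext x
  simp only [Set.mem_preimage, Set.mem_Icc, reverseIcc]
  split_ifs <;> omega

lemma setCompat_Icc_of_lt {a b c d : ℤ} (h : b < c) :
    SetCompat (Set.Icc a b) (Set.Icc c d) := by
  refine Or.inl (Set.disjoint_left.mpr fun x hx hx' => ?_)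
  simp only [Set.mem_Icc] at hx hx'
  omega

lemma setCompat_Icc_of_nested {a b c d : ℤ} (h₁ : a ≤ c) (h₂ : d ≤ b) :
    SetCompat (Set.Icc a b) (Set.Icc c d) :=
  Or.inr (Or.inr (Set.Icc_subset_Icc h₁ h₂))

lemma SetCompat.Icc_cases {a b c d : ℤ} (hab : a ≤ b) (hcd : c ≤ d)
    (h : SetCompat (Set.Icc a b) (Set.Icc c d)) :
    (b < c ∨ d < a) ∨ (c ≤ a ∧ b ≤ d) ∨ (a ≤ c ∧ d ≤ b) := by
  rcases h with h | h | h
  · left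
    by_contra! hlt
    refine Set.disjoint_left.mp h (?_ : max a c ∈ _) ?_ <;> simp only [Set.mem_Icc] <;> omega
  · exact Or.inr (Or.inl ((Set.Icc_subset_Icc_iff hab).mp h))
  · exact Or.inr (Or.inr ((Set.Icc_subset_Icc_iff hcd).mp h))

/-- Action of the generator reversing `[a, b]`. -/
noncomputable def actIcc (a b : ℤ) (w : Set ℤ → ℤ) : Set ℤ → ℤ :=
  reflectAt (Set.Icc a b) (permuteSets (reverseIcc a b) w)

lemma actIcc_involutive (a b : ℤ) : Function.Involutive (actIcc a b) := by
  intro w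
  unfold actIcc
  rw [permuteSets_reflectAt (reverseIcc_involutive a b), permuteSets_permuteSets_self
    (reverseIcc_involutive a b), reverseIcc_preimage_of_subset le_rfl le_rfl,
    add_sub_cancel_right, add_sub_cancel_left, reflectAt_reflectAt]

lemma actIcc_comm {a b c d : ℤ} (h : b < c) (w : Set ℤ → ℤ) :
    actIcc a b (actIcc c d w) = actIcc c d (actIcc a b w) := by
  unfold actIcc
  rw [permuteSets_reflectAt (reverseIcc_involutive a b), permuteSets_reflectAt (reverseIcc_involutive c d),
    reverseIcc_preimage_of_disjoint (Or.inl h), reverseIcc_preimage_of_disjoint (Or.inr h),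
    reflectAt_comm (setCompat_Icc_of_lt h)]
  congr 2
  funext B
  refine congrArg w (Set.ext fun x => ?_)
  have : reverseIcc a b (reverseIcc c d x) = reverseIcc c d (reverseIcc a b x) := by
    unfold reverseIcc
    split_ifs <;> omega
  simp only [Set.mem_preimage, this]

lemma actIcc_of_nested {a b c d : ℤ} (h₁ : a ≤ c) (h₂ : d ≤ b) (w : Set ℤ → ℤ) :
    actIcc a b (actIcc c d w) = actIcc (a + b - d) (a + b - c) (actIcc a b w) := by
  unfold actIcc
  rw [permuteSets_reflectAt (reverseIcc_involutive a b), permuteSets_reflectAt (reverseIcc_involutive _ _),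
    reverseIcc_preimage_of_subset h₁ h₂,
    reverseIcc_preimage_of_superset (c := a) (d := b) (by omega) (by omega),
    reflectAt_comm (setCompat_Icc_of_nested (by omega) (by omega))]
  congr 2
  funext B
  refine congrArg w (Set.ext fun x => ?_)
  have : reverseIcc a b (reverseIcc c d x) =
      reverseIcc (a + b - d) (a + b - c) (reverseIcc a b x) := by
    unfold reverseIcc
    split_ifs <;> omega
  simp only [Set.mem_preimage, this]

/-- The cactus group acts on integer weights of sets. -/
noncomputable def cactusAction (N : ℕ) : CactusGroup N →* Equiv.Perm (Set ℤ → ℤ) :=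
  PresentedGroup.toGroup
    (f := fun i => (actIcc_involutive (i.1.1 : ℤ) (i.1.2 + 1)).toPerm) <| by
    rintro r (⟨i⟩ | ⟨i, j, h⟩ | ⟨i, j, k, h1, h2, h3, h4⟩)
    · ext1 w
      simp [(actIcc_involutive _ _) w]
    · simp only [map_mul, map_inv, FreeGroup.lift_apply_of]
      rw [mul_inv_eq_one, mul_inv_eq_iff_eq_mul]
      ext1 w
      rcases h with h | h
      · exact actIcc_comm (by omega) w
      · exact (actIcc_comm (by omega) w).symm
    · simp only [map_mul, map_inv, FreeGroup.lift_apply_of]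
      rw [mul_inv_eq_one, mul_inv_eq_iff_eq_mul]
      ext1 w
      have hj := j.2
      have e₁ : (k.1.1 : ℤ) = i.1.1 + (i.1.2 + 1) - (j.1.2 + 1) := by omega
      have e₂ : (k.1.2 + 1 : ℤ) = i.1.1 + (i.1.2 + 1) - j.1.1 := by omega
      simp only [Equiv.Perm.mul_apply, Function.Involutive.coe_toPerm, e₁, e₂]
      exact actIcc_of_nested (by omega) (by omega) w

lemma cactusAction_gen {N p q : ℕ} (h : 1 ≤ p ∧ p ≤ q ∧ q ≤ N) (w : Set ℤ → ℤ) :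
    cactusAction N (cactusGen N p q) w = actIcc p (q + 1) w := by
  rw [cactusGen, dif_pos h, cactusAction, PresentedGroup.toGroup.of]
  rfl

/-! ### Regular weights -/

/-- Weights avoiding the walls, for which at most one of two incompatible sets is negative. -/
structure RegularWeight (w : Set ℤ → ℤ) : Prop where
  ne_zero (A : Set ℤ) : w A ≠ 0
  add_pos (A B : Set ℤ) : ¬SetCompat A B → 0 < w A + w B

lemma RegularWeight.permuteSets {w : Set ℤ → ℤ} (hw : RegularWeight w) {f : ℤ → ℤ}
    (hf : Function.Involutive f) : RegularWeight (permuteSets f w) where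
  ne_zero A := hw.ne_zero _
  add_pos A B h := hw.add_pos _ _ fun h' => h <| by
    simpa [hf.preimage_preimage] using h'.preimage f

lemma RegularWeight.reflectAt_pos {w : Set ℤ → ℤ} (hw : RegularWeight w) {A B : Set ℤ}
    (hA : 0 < w A) (h : ¬SetCompat A B) : 0 < reflectAt A w B := by
  rw [reflectAt_of_not_compat _ h]
  have := hw.add_pos A B h
  omega

lemma le_reflectAt {w : Set ℤ → ℤ} {A B : Set ℤ} (hA : 0 < w A) (hB : B ≠ A) :
    w B ≤ reflectAt A w B := by
  by_cases h : SetCompat A B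
  · rw [reflectAt_of_compat _ hB h]
  · rw [reflectAt_of_not_compat _ h]
    omega

lemma RegularWeight.reflectAt {w : Set ℤ → ℤ} (hw : RegularWeight w) {A : Set ℤ}
    (hA : 0 < w A) : RegularWeight (reflectAt A w) where
  ne_zero B := by
    by_cases hB : B = A
    · subst hB
      rw [reflectAt_self]
      omega
    by_cases h : SetCompat A B
    · rw [reflectAt_of_compat _ hB h]
      exact hw.ne_zero B
    · exact (hw.reflectAt_pos hA h).ne'
  add_pos B C h := by
    by_cases hB : B = A
    · subst hB
      have := hw.add_pos _ _ h
      rw [reflectAt_self, reflectAt_of_not_compat _ h]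
      omega
    by_cases hC : C = A
    · subst hC
      have h' := mt SetCompat.symm h
      have := hw.add_pos _ _ h'
      rw [reflectAt_self, reflectAt_of_not_compat _ h']
      omega
    have := hw.add_pos _ _ h
    have := le_reflectAt (w := w) hA hB
    have := le_reflectAt (w := w) hA hC
    omega

/-! ### The folded action -/

/-- The mirror symmetry of the points `1, …, 2n`. -/
def mirror (n : ℕ) (x : ℤ) : ℤ := 2 * n + 1 - x

lemma mirror_involutive (n : ℕ) : Function.Involutive (mirror n) := by
  intro x
  unfold mirror
  omega

lemma mirror_preimage_Icc (n : ℕ) (a b : ℤ) :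
    mirror n ⁻¹' Set.Icc a b = Set.Icc (2 * n + 1 - b) (2 * n + 1 - a) := by
  ext x
  simp only [Set.mem_preimage, Set.mem_Icc, mirror]
  omega

/-- Regular weights invariant under the mirror symmetry. -/
structure SymmetricRegular (n : ℕ) (w : Set ℤ → ℤ) : Prop extends RegularWeight w where
  mirror_eq (A : Set ℤ) : w (mirror n ⁻¹' A) = w A

/-- The right end of the interval of points attached to a generator. -/
def rightEnd {n : ℕ} (i : CactusIdx n) : ℤ := if i.1.2 = n then 2 * n + 1 - i.1.1 else i.1.2 + 1

/-- The interval of points attached to a generator. -/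
def support {n : ℕ} (i : CactusIdx n) : Set ℤ := Set.Icc (i.1.1 : ℤ) (rightEnd i)

/-- The permutation of points attached to a generator. -/
def supportReverse {n : ℕ} (i : CactusIdx n) (x : ℤ) : ℤ :=
  if i.1.2 = n then reverseIcc i.1.1 (rightEnd i) x
  else reverseIcc (2 * n + 1 - rightEnd i) (2 * n + 1 - i.1.1)
    (reverseIcc i.1.1 (rightEnd i) x)

/-- The composite of the commuting reflections attached to a generator. -/
noncomputable def foldReflect {n : ℕ} (i : CactusIdx n) (w : Set ℤ → ℤ) : Set ℤ → ℤ :=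
  if i.1.2 = n then reflectAt (support i) w
  else reflectAt (support i) (reflectAt (mirror n ⁻¹' support i) w)

lemma rightEnd_bounds {n : ℕ} (i : CactusIdx n) :
    (i.1.2 = n ∧ rightEnd i = 2 * n + 1 - i.1.1) ∨
      (i.1.2 < n ∧ rightEnd i = i.1.2 + 1) := by
  have := i.2
  unfold rightEnd
  split_ifs with h
  · exact Or.inl ⟨h, rfl⟩
  · exact Or.inr ⟨by omega, rfl⟩

lemma left_le_rightEnd {n : ℕ} (i : CactusIdx n) : (i.1.1 : ℤ) ≤ rightEnd i := by
  have := i.2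
  rcases rightEnd_bounds i with h | h <;> omega

lemma supportReverse_involutive {n : ℕ} (i : CactusIdx n) :
    Function.Involutive (supportReverse i) := by
  intro x
  have := i.2
  have := rightEnd_bounds i
  unfold supportReverse reverseIcc
  split_ifs <;> omega

lemma supportReverse_mirror {n : ℕ} (i : CactusIdx n) (x : ℤ) :
    supportReverse i (mirror n x) = mirror n (supportReverse i x) := by
  have := i.2
  have := rightEnd_bounds i
  unfold supportReverse reverseIcc mirror
  split_ifs <;> omega

lemma supportReverse_preimage_support {n : ℕ} (i : CactusIdx n) :
    supportReverse i ⁻¹' support i = support i := by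
  have := i.2
  have := rightEnd_bounds i
  ext x
  simp only [support, Set.mem_preimage, Set.mem_Icc]
  unfold supportReverse reverseIcc
  split_ifs <;> omega

lemma mirror_support_of_eq {n : ℕ} {i : CactusIdx n} (h : i.1.2 = n) :
    mirror n ⁻¹' support i = support i := by
  rw [support, mirror_preimage_Icc, rightEnd, if_pos h]
  congr 1
  ring

lemma support_lt_mirror {n : ℕ} {i : CactusIdx n} (h : i.1.2 ≠ n) :
    rightEnd i < 2 * n + 1 - rightEnd i := by
  have := i.2
  have := rightEnd_bounds i
  omega

lemma setCompat_support_mirror {n : ℕ} {i : CactusIdx n} (h : i.1.2 ≠ n) :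
    SetCompat (support i) (mirror n ⁻¹' support i) := by
  rw [support, mirror_preimage_Icc]
  exact setCompat_Icc_of_lt (support_lt_mirror h)

lemma support_ne_mirror {n : ℕ} {i : CactusIdx n} (h : i.1.2 ≠ n) (j : CactusIdx n) :
    support j ≠ mirror n ⁻¹' support i := by
  rw [support, support, mirror_preimage_Icc]
  intro he
  have h₁ : (j.1.1 : ℤ) ∈ Set.Icc (2 * n + 1 - rightEnd i) (2 * n + 1 - (i.1.1 : ℤ)) :=
    he ▸ Set.left_mem_Icc.mpr (left_le_rightEnd j)
  have := h₁.1
  have := i.2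
  have := j.2
  have := rightEnd_bounds i
  omega

lemma support_injective {n : ℕ} : Function.Injective (support (n := n)) := by
  intro i j h
  have hi := left_le_rightEnd i
  have hj := left_le_rightEnd j
  have h₁ := (Set.Icc_subset_Icc_iff hi).mp h.subset
  have h₂ := (Set.Icc_subset_Icc_iff hj).mp h.superset
  have := rightEnd_bounds i
  have := rightEnd_bounds j
  have := i.2
  have := j.2
  exact Subtype.ext (Prod.ext (by omega) (by omega))

lemma SymmetricRegular.permuteSets {n : ℕ} {w : Set ℤ → ℤ} (hw : SymmetricRegular n w)
    (i : CactusIdx n) : SymmetricRegular n (permuteSets (supportReverse i) w) where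
  toRegularWeight := hw.toRegularWeight.permuteSets (supportReverse_involutive i)
  mirror_eq A := by
    have : supportReverse i ⁻¹' (mirror n ⁻¹' A) = mirror n ⁻¹' (supportReverse i ⁻¹' A) := by
      ext x
      simp only [Set.mem_preimage, supportReverse_mirror]
    simp only [_root_.permuteSets, this, hw.mirror_eq]

lemma SymmetricRegular.foldReflect {n : ℕ} {w : Set ℤ → ℤ} (hw : SymmetricRegular n w)
    {i : CactusIdx n} (hi : 0 < w (support i)) : SymmetricRegular n (foldReflect i w) where
  toRegularWeight := by
    unfold _root_.foldReflect
    split_ifs with h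
    · exact hw.toRegularWeight.reflectAt hi
    · refine (hw.toRegularWeight.reflectAt (by rwa [hw.mirror_eq])).reflectAt ?_
      rwa [reflectAt_of_compat _ (support_ne_mirror h i) (setCompat_support_mirror h).symm]
  mirror_eq A := by
    have hm := mirror_involutive n
    have hwm : _root_.permuteSets (mirror n) w = w := funext hw.mirror_eq
    refine congrFun (?_ : _root_.permuteSets (mirror n) (_root_.foldReflect i w) = _) A
    unfold _root_.foldReflect
    split_ifs with h
    · rw [permuteSets_reflectAt hm, hwm, mirror_support_of_eq h]
    · rw [permuteSets_reflectAt hm, permuteSets_reflectAt hm, hwm, hm.preimage_preimage,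
        reflectAt_comm (setCompat_support_mirror h)]

lemma foldReflect_support {n : ℕ} (i : CactusIdx n) (w : Set ℤ → ℤ) :
    foldReflect i w (support i) = -w (support i) := by
  unfold foldReflect
  split_ifs with h
  · exact reflectAt_self _ _
  · rw [reflectAt_self, reflectAt_of_compat _ (support_ne_mirror h i)
      (setCompat_support_mirror h).symm]

lemma SymmetricRegular.compat_of_foldReflect_neg {n : ℕ} {w : Set ℤ → ℤ}
    (hw : SymmetricRegular n w) {i j : CactusIdx n} (hi : 0 < w (support i)) (hij : i ≠ j)
    (hj : _root_.foldReflect i w (support j) < 0) :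
    SetCompat (support i) (support j) ∧ w (support j) < 0 := by
  have hne : support j ≠ support i := fun h => hij (support_injective h).symm
  unfold _root_.foldReflect at hj
  split_ifs at hj with h
  · have hc : SetCompat (support i) (support j) := by
      by_contra hc
      exact absurd hj (hw.reflectAt_pos hi hc).not_gt
    exact ⟨hc, by rwa [reflectAt_of_compat _ hne hc] at hj⟩
  · have hm : 0 < w (mirror n ⁻¹' support i) := by rwa [hw.mirror_eq]
    have hi' : 0 < reflectAt (mirror n ⁻¹' support i) w (support i) := by
      rwa [reflectAt_of_compat _ (support_ne_mirror h i) (setCompat_support_mirror h).symm]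
    have hc : SetCompat (support i) (support j) := by
      by_contra hc
      exact absurd hj ((hw.toRegularWeight.reflectAt hm).reflectAt_pos hi' hc).not_gt
    rw [reflectAt_of_compat _ hne hc] at hj
    exact ⟨hc, (le_reflectAt hm (support_ne_mirror h j)).trans_lt hj⟩

lemma cactusAction_foldHom_gen {n : ℕ} (i : CactusIdx n) (w : Set ℤ → ℤ) :
    cactusAction (2 * n - 1) (foldHom n (SpCactusGroup.gen i)) w =
      foldReflect i (permuteSets (supportReverse i) w) := by
  have hi := i.2
  rw [foldHom_gen, foldGen, foldReflect]
  split_ifs with h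
  · rw [cactusAction_gen (by omega), actIcc, support]
    have e : (((2 * n - i.1.1 : ℕ) : ℤ) + 1) = rightEnd i := by
      rw [rightEnd, if_pos h]; omega
    rw [e]
    congr 2
    funext x
    rw [supportReverse, if_pos h]
  · have e₁ : ((i.1.2 : ℤ) + 1) = rightEnd i := by rw [rightEnd, if_neg h]
    have e₂ : (((2 * n - i.1.2 : ℕ) : ℤ)) = 2 * n + 1 - rightEnd i := by
      rw [rightEnd, if_neg h]; omega
    have e₃ : (((2 * n - i.1.1 : ℕ) : ℤ) + 1) = 2 * n + 1 - i.1.1 := by omega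
    rw [sPrime, map_mul, Equiv.Perm.mul_apply, cactusAction_gen (by omega),
      cactusAction_gen (by omega), e₁, e₂, e₃, actIcc, actIcc,
      permuteSets_reflectAt (reverseIcc_involutive _ _),
      reverseIcc_preimage_of_disjoint (Or.inl (support_lt_mirror h)), support,
      mirror_preimage_Icc]
    congr 2
    funext B
    refine congrArg w (Set.ext fun x => ?_)
    have := rightEnd_bounds i
    have : reverseIcc i.1.1 (rightEnd i)
        (reverseIcc (2 * n + 1 - rightEnd i) (2 * n + 1 - i.1.1) x) = supportReverse i x := by
      unfold supportReverse reverseIcc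
      split_ifs <;> omega
    simp only [Set.mem_preimage, this]

/-- Compatible generators can be exchanged, and the exchange matches the permutation of points. -/
lemma exists_exchange {n : ℕ} {i j : CactusIdx n} (hc : SetCompat (support i) (support j)) :
    ∃ i' j' : CactusIdx n,
      SpCactusGroup.gen j * SpCactusGroup.gen i = SpCactusGroup.gen i' * SpCactusGroup.gen j' ∧
      (supportReverse i ⁻¹' support j = support j' ∨
        supportReverse i ⁻¹' support j = mirror n ⁻¹' support j') := by
  have hi := i.2
  have hj := j.2
  have bi := rightEnd_bounds i
  have bj := rightEnd_bounds j
  rcases hc.Icc_cases (left_le_rightEnd i) (left_le_rightEnd j) with h | h | h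
  · refine ⟨i, j, SpCactusGroup.gen_comm j i (by omega), Or.inl ?_⟩
    ext x
    simp only [support, Set.mem_preimage, Set.mem_Icc]
    unfold supportReverse reverseIcc
    split_ifs <;> omega
  · by_cases hjn : j.1.2 = n
    · refine ⟨i, j, SpCactusGroup.gen_comm_of_eq j i hjn (by omega), Or.inl ?_⟩
      ext x
      simp only [support, Set.mem_preimage, Set.mem_Icc]
      unfold supportReverse reverseIcc
      split_ifs <;> omega
    · refine ⟨⟨(j.1.1 + j.1.2 - i.1.2, j.1.1 + j.1.2 - i.1.1), by dsimp only; omega⟩, j,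
        SpCactusGroup.gen_mul_of_nested j i _ (by omega) (by omega) (by omega) rfl rfl,
        Or.inl ?_⟩
      ext x
      simp only [support, Set.mem_preimage, Set.mem_Icc]
      unfold supportReverse reverseIcc
      split_ifs <;> omega
  · by_cases hin : i.1.2 = n
    · refine ⟨i, j, (SpCactusGroup.gen_comm_of_eq i j hin (by omega)).symm, Or.inr ?_⟩
      ext x
      simp only [support, Set.mem_preimage, Set.mem_Icc]
      unfold supportReverse reverseIcc mirror
      split_ifs <;> omega
    · set k : CactusIdx n :=
        ⟨(i.1.1 + i.1.2 - j.1.2, i.1.1 + i.1.2 - j.1.1), by dsimp only; omega⟩ with hk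
      have hk₁ : k.1.1 = i.1.1 + i.1.2 - j.1.2 := rfl
      have hk₂ : k.1.2 = i.1.1 + i.1.2 - j.1.1 := rfl
      have bk := rightEnd_bounds k
      refine ⟨i, k, (SpCactusGroup.gen_mul_of_nested i k j (by omega) (by omega) (by omega)
        (by omega) (by omega)).symm, Or.inl ?_⟩
      ext x
      simp only [support, Set.mem_preimage, Set.mem_Icc]
      unfold supportReverse reverseIcc
      split_ifs <;> omega

/-- Along the orbit of the constant weight, negativity on the support of a generator detects
that this generator shortens the group element. -/
lemma orbit_symmetricRegular {n : ℕ} (g : SpCactusGroup n) :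
    SymmetricRegular n (cactusAction (2 * n - 1) (foldHom n g) fun _ => 1) ∧
      ∀ j : CactusIdx n, cactusAction (2 * n - 1) (foldHom n g) (fun _ => 1) (support j) < 0 →
        (SpCactusGroup.gen j * g).length < g.length := by
  induction hk : g.length using Nat.strong_induction_on generalizing g with
  | _ k ih =>
  subst hk
  rcases SpCactusGroup.eq_one_or_exists_length_lt g with rfl | ⟨i, h, rfl, hlt⟩
  · simp only [map_one, Equiv.Perm.one_apply]
    exact ⟨⟨⟨fun _ => one_ne_zero, fun _ _ _ => by norm_num⟩, fun _ => rfl⟩,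
      fun j hj => absurd hj (by norm_num)⟩
  obtain ⟨hreg, hdesc⟩ := ih _ hlt h rfl
  simp only [map_mul, Equiv.Perm.mul_apply, cactusAction_foldHom_gen]
  set w := cactusAction (2 * n - 1) (foldHom n h) fun _ => 1
  have hpos : 0 < w (support i) := by
    have h₁ := hreg.ne_zero (support i)
    have h₂ := mt (hdesc i) hlt.not_gt
    omega
  have hpos' : 0 < permuteSets (supportReverse i) w (support i) := by
    rwa [permuteSets, supportReverse_preimage_support]
  refine ⟨(hreg.permuteSets i).foldReflect hpos', fun j hj => ?_⟩
  by_cases hij : i = j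
  · subst hij
    rwa [SpCactusGroup.gen_mul_cancel_left]
  obtain ⟨hc, hneg⟩ := (hreg.permuteSets i).compat_of_foldReflect_neg hpos' hij hj
  obtain ⟨i', j', hex, hsupp⟩ := exists_exchange hc
  have hj' : w (support j') < 0 := by
    rcases hsupp with hs | hs
    · rwa [permuteSets, hs] at hneg
    · rwa [permuteSets, hs, hreg.mirror_eq] at hneg
  have h₁ := hdesc j' hj'
  have h₂ := SpCactusGroup.length_gen_mul_le i' (SpCactusGroup.gen j' * h)
  rw [← mul_assoc, hex, mul_assoc]
  omega

lemma foldHom_injective (n : ℕ) : Function.Injective (foldHom n) := by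
  rw [injective_iff_map_eq_one]
  intro g hg
  rcases SpCactusGroup.eq_one_or_exists_length_lt g with h | ⟨i, h, rfl, hlt⟩
  · exact h
  exfalso
  obtain ⟨hreg, hdesc⟩ := orbit_symmetricRegular h
  have h₁ := hreg.ne_zero (support i)
  have h₂ := mt (hdesc i) hlt.not_gt
  have h₃ := congrArg (fun x => cactusAction (2 * n - 1) x (fun _ => 1) (support i)) hg
  simp only [map_mul, Equiv.Perm.mul_apply, cactusAction_foldHom_gen, foldReflect_support,
    permuteSets, supportReverse_preimage_support, map_one, Equiv.Perm.one_apply] at h₃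
  omega

/-- The group homomorphism `Γ : J_{sp(2n)} → J_{2n}` determined by
`s_{[p,q]} ↦ s'_{[p,q]}` (`1 ≤ p ≤ q ≤ n-1`) and `s_{[p,n]} ↦ s_{[p,2n-p]}`
(`1 ≤ p ≤ n`) is injective; hence `J_{sp(2n)}` embeds as a subgroup of `J_{2n}`. -/
theorem stmt6 (n : ℕ) (hn : 2 ≤ n) :
    ∃ Γ : SpCactusGroup n →* CactusGroup (2 * n - 1),
      Function.Injective Γ ∧
      (∀ p q : ℕ, 1 ≤ p → p ≤ q → q ≤ n - 1 → Γ (spGen n p q) = sPrime n p q) ∧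
      (∀ p : ℕ, 1 ≤ p → p ≤ n →
        Γ (spGen n p n) = cactusGen (2 * n - 1) p (2 * n - p)) := by
  refine ⟨foldHom n, foldHom_injective n, fun p q hp hpq hq => ?_, fun p hp hpn => ?_⟩
  · rw [spGen, dif_pos (by omega)]
    refine (foldHom_gen n _).trans ?_
    simp only [foldGen]
    rw [if_neg (by omega)]
  · rw [spGen, dif_pos (by omega)]
    refine (foldHom_gen n _).trans ?_
    simp only [foldGen, if_true]
end

section
/- In the symplectic cactus group J_{sp(2n)}, with p_k := t_k t_{k−1} ⋯ t_2 t_1 (the symplectic promotion elements), one has: (1) s_{[1,i]} = p_1 p_2 ⋯ p_i for all 1 ≤ i ≤ n−1, and (2) s_{[i,n]} = t_{2n−i} t_{2n−i−1} ⋯ t_n for all 1 ≤ i ≤ n; in particular the symplectic Bender–Knuth elements t_1, …, t_{2n−1} generate J_{sp(2n)} modulo its defining relations, and the corresponding symplectic Bender–Knuth involutions generate the symplectic Berenstein–Kirillov group. -/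
/-- The symplectic Bender–Knuth elements `t_i`, `1 ≤ i ≤ 2n-1`, of `J_{sp(2n)}`:
`t_1 = s_{[1,1]}`; `t_i = s_{[1,i-1]} s_{[1,i]} s_{[1,i-1]} s_{[1,i-2]}` for
`2 ≤ i ≤ n-1` (with `s_{[1,0]} = 1`); `t_n = s_{[n,n]}`; and
`t_{n+i-1} = s_{[n-i+1,n]} s_{[n-i+2,n]}` for `2 ≤ i ≤ n` (with `s_{[n+1,n]} = 1`).
(Note `spGen` is already `1` on invalid indices, implementing the conventions.) -/
def bk (n : ℕ) (i : ℕ) : SpCactusGroup n :=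
  if i = 1 then spGen n 1 1
  else if i ≤ n - 1 then spGen n 1 (i - 1) * spGen n 1 i * spGen n 1 (i - 1) * spGen n 1 (i - 2)
  else if i = n then spGen n n n
  else spGen n (2 * n - i) n * spGen n (2 * n - i + 1) n

/-- The symplectic promotion elements `p_k := t_k t_{k-1} ⋯ t_2 t_1` in `J_{sp(2n)}`. -/
def pProm (n : ℕ) : ℕ → SpCactusGroup n
  | 0 => 1
  | k + 1 => bk n (k + 1) * pProm n k

/-- `qProd n i = p_1 p_2 ⋯ p_i`. -/
def qProd (n : ℕ) : ℕ → SpCactusGroup n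
  | 0 => 1
  | i + 1 => qProd n i * pProm n (i + 1)

/-- `rProd n m = t_{n+m} t_{n+m-1} ⋯ t_n`. -/
def rProd (n : ℕ) : ℕ → SpCactusGroup n
  | 0 => bk n n
  | m + 1 => bk n (n + (m + 1)) * rProd n m

theorem spGen_mul_self (n p q : ℕ) : spGen n p q * spGen n p q = 1 := by
  unfold spGen
  split_ifs with h
  · exact PresentedGroup.one_of_mem (rels := {x | SpCactusRel n x})
      (SpCactusRel.sq ⟨(p, q), h⟩)
  · exact one_mul 1

theorem spGen_of_not_valid {n p q : ℕ} (h : ¬(1 ≤ p ∧ p ≤ q ∧ q ≤ n)) : spGen n p q = 1 :=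
  dif_neg h

/-- Every generator `s_{[k,l]}` with `l ≤ n-1` is a conjugate of `s_{[1,l-k+1]}` by `s_{[1,l]}`. -/
theorem spGen_eq_conj {n k l : ℕ} (hk : 1 ≤ k) (hkl : k ≤ l) (hl : l ≤ n - 1) :
    spGen n k l = spGen n 1 l * spGen n 1 (l - k + 1) * (spGen n 1 l)⁻¹ := by
  have h₁ : 1 ≤ 1 ∧ 1 ≤ l ∧ l ≤ n := by omega
  have h₂ : 1 ≤ 1 ∧ 1 ≤ l - k + 1 ∧ l - k + 1 ≤ n := by omega
  have h₃ : 1 ≤ k ∧ k ≤ l ∧ l ≤ n := by omega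
  have h := PresentedGroup.one_of_mem (rels := {x | SpCactusRel n x})
    (SpCactusRel.nestA ⟨(1, l), h₁⟩ ⟨(1, l - k + 1), h₂⟩ ⟨(k, l), h₃⟩ hl le_rfl
      (by change l - k + 1 ≤ l; omega) (by change k = 1 + l - (l - k + 1); omega)
      (by change l = 1 + l - 1; omega))
  rw [spGen, spGen, spGen, dif_pos h₁, dif_pos h₂, dif_pos h₃]
  simp only [map_mul, map_inv] at h
  exact (mul_inv_eq_one.mp h).symm

theorem pProm_succ_eq {n i : ℕ} (hi : i + 1 ≤ n - 1) :
    pProm n (i + 1) = spGen n 1 i * spGen n 1 (i + 1) := by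
  induction i with
  | zero => simp [pProm, bk, spGen_of_not_valid (n := n) (p := 1) (q := 0) (by omega)]
  | succ i ih =>
    rw [pProm, ih (by omega), bk, if_neg (by omega), if_pos hi,
      show i + 1 + 1 - 1 = i + 1 by omega, show i + 1 + 1 - 2 = i by omega]
    calc _ = spGen n 1 (i + 1) * spGen n 1 (i + 1 + 1) * (spGen n 1 (i + 1) *
          (spGen n 1 i * spGen n 1 i) * spGen n 1 (i + 1)) := by group
      _ = _ := by rw [spGen_mul_self, mul_one, spGen_mul_self, mul_one]

theorem qProd_eq_spGen {n i : ℕ} (hi : i ≤ n - 1) : qProd n i = spGen n 1 i := by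
  induction i with
  | zero => rw [spGen_of_not_valid (by omega), qProd]
  | succ i ih =>
    rw [qProd, ih (by omega), pProm_succ_eq hi, ← mul_assoc, spGen_mul_self, one_mul]

theorem rProd_eq_spGen {n m : ℕ} (hn : 2 ≤ n) (hm : m < n) :
    rProd n m = spGen n (n - m) n := by
  induction m with
  | zero => rw [rProd, bk, if_neg (by omega), if_neg (by omega), if_pos rfl, Nat.sub_zero]
  | succ m ih =>
    rw [rProd, ih (by omega), bk, if_neg (by omega), if_neg (by omega), if_neg (by omega),
      show 2 * n - (n + (m + 1)) + 1 = n - m by omega,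
      show 2 * n - (n + (m + 1)) = n - (m + 1) by omega, mul_assoc, spGen_mul_self, mul_one]

section Membership

variable {n N : ℕ} {H : Subgroup (SpCactusGroup n)}

theorem pProm_mem (hH : ∀ i, 1 ≤ i → i ≤ N → bk n i ∈ H) {k : ℕ} (hk : k ≤ N) :
    pProm n k ∈ H := by
  induction k with
  | zero => exact H.one_mem
  | succ k ih => exact H.mul_mem (hH _ (by omega) hk) (ih (by omega))

theorem qProd_mem (hH : ∀ i, 1 ≤ i → i ≤ N → bk n i ∈ H) {k : ℕ} (hk : k ≤ N) :
    qProd n k ∈ H := by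
  induction k with
  | zero => exact H.one_mem
  | succ k ih => exact H.mul_mem (ih (by omega)) (pProm_mem hH hk)

theorem rProd_mem (hn : 1 ≤ n) (hH : ∀ i, 1 ≤ i → i ≤ N → bk n i ∈ H) {m : ℕ}
    (hm : n + m ≤ N) : rProd n m ∈ H := by
  induction m with
  | zero => exact hH n hn hm
  | succ m ih => exact H.mul_mem (hH _ (by omega) hm) (ih (by omega))

end Membership

theorem closure_bk_eq_top {n : ℕ} (hn : 2 ≤ n) :
    Subgroup.closure
      {x : SpCactusGroup n | ∃ i, 1 ≤ i ∧ i ≤ 2 * n - 1 ∧ x = bk n i} = ⊤ := by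
  set H := Subgroup.closure {x : SpCactusGroup n | ∃ i, 1 ≤ i ∧ i ≤ 2 * n - 1 ∧ x = bk n i}
  have hH : ∀ i, 1 ≤ i → i ≤ 2 * n - 1 → bk n i ∈ H := fun i h₁ h₂ =>
    Subgroup.subset_closure ⟨i, h₁, h₂, rfl⟩
  have hA : ∀ i, i ≤ n - 1 → spGen n 1 i ∈ H := fun i hi =>
    qProd_eq_spGen hi ▸ qProd_mem hH (by omega)
  rw [eq_top_iff, ← PresentedGroup.closure_range_of, Subgroup.closure_le]
  rintro _ ⟨⟨⟨k, l⟩, h⟩, rfl⟩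
  obtain ⟨hk, hkl, hl⟩ : 1 ≤ k ∧ k ≤ l ∧ l ≤ n := h
  have hgen : spGen n k l = PresentedGroup.of ⟨(k, l), hk, hkl, hl⟩ := by
    rw [spGen, dif_pos ⟨hk, hkl, hl⟩]
  rw [← hgen, SetLike.mem_coe]
  rcases hl.eq_or_lt with rfl | hlt
  · have h := rProd_eq_spGen (m := l - k) hn (by omega)
    rw [Nat.sub_sub_self hkl] at h
    exact h ▸ rProd_mem (by omega) hH (by omega)
  · rw [spGen_eq_conj hk hkl (by omega)]
    exact H.mul_mem (H.mul_mem (hA _ (by omega)) (hA _ (by omega))) (H.inv_mem (hA _ (by omega)))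

/-- In `J_{sp(2n)}`: (1) `s_{[1,i]} = p_1 p_2 ⋯ p_i` for `1 ≤ i ≤ n-1`;
(2) `s_{[i,n]} = t_{2n-i} t_{2n-i-1} ⋯ t_n` for `1 ≤ i ≤ n`; in particular the
symplectic Bender–Knuth elements `t_1, …, t_{2n-1}` generate `J_{sp(2n)}`. -/
theorem stmt19 (n : ℕ) (hn : 2 ≤ n) :
    (∀ i : ℕ, 1 ≤ i → i ≤ n - 1 → spGen n 1 i = qProd n i) ∧
    (∀ i : ℕ, 1 ≤ i → i ≤ n → spGen n i n = rProd n (n - i)) ∧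
    Subgroup.closure
      {x : SpCactusGroup n | ∃ i, 1 ≤ i ∧ i ≤ 2 * n - 1 ∧ x = bk n i} = ⊤ := by
  refine ⟨fun i _ hi => (qProd_eq_spGen hi).symm, fun i h₁ hi => ?_, closure_bk_eq_top hn⟩
  rw [rProd_eq_spGen hn (by omega), Nat.sub_sub_self hi]
end
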